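/- arXiv:1206.1847 — 4 statements merged into one kernel-verified Lean document; each statement's English description precedes it below -/
import Mathlib

section
/- For every α ∈ {x, y, z} and every ℓ ∈ ℕ, the normalized even moments of the scaled total spin operator converge: lim_{N→∞} 2^{-N} N^{-ℓ} tr((Ŝ_α^{(N)})^{2ℓ}) = (2ℓ)! / (2^{3ℓ} ℓ!). -/
open Matrix Filter Topology MeasureTheory

/-- The spin-1/2 matrices: `spinMat 0 = s_x`, `spinMat 1 = s_y`, `spinMat 2 = s_z`. -/
noncomputable def spinMat : Fin 3 → Matrix (Fin 2) (Fin 2) ℂ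
  | 0 => !![0, 1/2; 1/2, 0]
  | 1 => !![0, -Complex.I/2; Complex.I/2, 0]
  | 2 => !![1/2, 0; 0, -1/2]

/-- The `N`-fold Kronecker (tensor) product of `2 × 2` matrices, realized on the
index type `Fin N → Fin 2` of cardinality `2^N`. -/
noncomputable def kronPow (N : ℕ) (A : Fin N → Matrix (Fin 2) (Fin 2) ℂ) :
    Matrix (Fin N → Fin 2) (Fin N → Fin 2) ℂ :=
  Matrix.of fun f g => ∏ k, A k (f k) (g k)

/-- The total spin operator `Ŝ_α^{(N)} = Σ_{j=1}^N I₂^{⊗(j-1)} ⊗ s_α ⊗ I₂^{⊗(N-j)}`. -/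
noncomputable def totalSpin (N : ℕ) (α : Fin 3) :
    Matrix (Fin N → Fin 2) (Fin N → Fin 2) ℂ :=
  ∑ j : Fin N, kronPow N (fun k => if k = j then spinMat α else 1)

lemma kronPow_mul (N : ℕ) (A B : Fin N → Matrix (Fin 2) (Fin 2) ℂ) :
    kronPow N A * kronPow N B = kronPow N (fun k => A k * B k) := by
  ext f g
  simp only [kronPow, Matrix.mul_apply, Matrix.of_apply]
  rw [Finset.prod_univ_sum, Fintype.piFinset_univ]
  simp only [Finset.prod_mul_distrib]

lemma kronPow_one (N : ℕ) : kronPow N (fun _ => 1) = 1 := by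
  ext f g
  simp only [kronPow, Matrix.of_apply, Matrix.one_apply]
  by_cases h : f = g
  · subst h; simp
  · rw [if_neg h]
    obtain ⟨k, hk⟩ := Function.ne_iff.mp h
    exact Finset.prod_eq_zero (Finset.mem_univ k) (if_neg hk)

lemma exists_conj (α : Fin 3) : ∃ U V : Matrix (Fin 2) (Fin 2) ℂ,
    U * V = 1 ∧ V * U = 1 ∧ U * spinMat α * V = spinMat 2 := by
  fin_cases α
  · refine ⟨!![1, 1; 1, -1], !![1/2, 1/2; 1/2, -1/2], ?_, ?_, ?_⟩ <;>
      ext i j <;> fin_cases i <;> fin_cases j <;>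
      simp [spinMat, Matrix.mul_apply, Fin.sum_univ_two] <;> norm_num
  · refine ⟨!![1/2, -Complex.I/2; 1/2, Complex.I/2], !![1, 1; Complex.I, -Complex.I], ?_, ?_, ?_⟩ <;>
      ext i j <;> fin_cases i <;> fin_cases j <;>
      simp [spinMat, Matrix.mul_apply, Fin.sum_univ_two] <;> ring_nf <;>
      simp [Complex.I_sq] <;> norm_num
  · exact ⟨1, 1, by simp, by simp, by simp⟩

lemma totalSpin_conj (N : ℕ) (α : Fin 3) : ∃ U V : Matrix (Fin N → Fin 2) (Fin N → Fin 2) ℂ,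
    U * V = 1 ∧ V * U = 1 ∧ U * totalSpin N α * V = totalSpin N 2 := by
  obtain ⟨U, V, h1, h2, h3⟩ := exists_conj α
  refine ⟨kronPow N fun _ => U, kronPow N fun _ => V, ?_, ?_, ?_⟩
  · rw [kronPow_mul, h1, kronPow_one]
  · rw [kronPow_mul, h2, kronPow_one]
  · simp only [totalSpin, Finset.mul_sum, Finset.sum_mul, kronPow_mul]
    refine Finset.sum_congr rfl fun j _ => ?_
    congr 1
    funext k
    split_ifs
    · exact h3
    · rw [mul_one, h1]

/-- diagonal entries of `s_z` -/
noncomputable def sg (x : Fin 2) : ℂ := if x = 0 then 1/2 else -1/2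

lemma spinMat_two : spinMat 2 = Matrix.diagonal sg := by
  ext i j
  fin_cases i <;> fin_cases j <;> simp [spinMat, sg]

lemma totalSpin_two (N : ℕ) :
    totalSpin N 2 = Matrix.diagonal (fun f : Fin N → Fin 2 => ∑ k, sg (f k)) := by
  ext f g
  simp only [totalSpin, kronPow, Matrix.sum_apply, Matrix.of_apply, spinMat_two]
  by_cases h : f = g
  · subst h
    rw [Matrix.diagonal_apply_eq]
    refine Finset.sum_congr rfl fun j _ => ?_
    rw [Finset.prod_eq_single j]
    · simp
    · intro b _ hb; simp [hb]
    · simp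
  · rw [Matrix.diagonal_apply_ne _ h]
    obtain ⟨k, hk⟩ := Function.ne_iff.mp h
    refine Finset.sum_eq_zero fun j _ => Finset.prod_eq_zero (Finset.mem_univ k) ?_
    split_ifs
    · exact Matrix.diagonal_apply_ne _ hk
    · exact Matrix.one_apply_ne hk

/-- unnormalized moments -/
noncomputable def mom (m N : ℕ) : ℂ := ∑ f : Fin N → Fin 2, (∑ k, sg (f k)) ^ m

lemma trace_eq (N : ℕ) (α : Fin 3) (m : ℕ) : (totalSpin N α ^ m).trace = mom m N := by
  obtain ⟨U, V, h1, h2, h3⟩ := totalSpin_conj N α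
  have key : totalSpin N 2 ^ m = U * totalSpin N α ^ m * V := by
    induction m with
    | zero => simp [h1]
    | succ m ih =>
      rw [pow_succ, ih, ← h3, pow_succ]
      calc _ = U * totalSpin N α ^ m * (V * U) * totalSpin N α * V := by simp only [mul_assoc]
        _ = _ := by rw [h2]; simp only [mul_assoc, one_mul]
  have : (totalSpin N 2 ^ m).trace = (totalSpin N α ^ m).trace := by
    rw [key, Matrix.trace_mul_comm, ← mul_assoc, h2, one_mul]
  rw [← this, totalSpin_two, Matrix.diagonal_pow, Matrix.trace_diagonal]
  rfl

lemma mom_succ (m N : ℕ) : mom (m + 1) (N + 1) =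
    (N + 1) * ∑ j ∈ Finset.range (m + 1),
      (m.choose j : ℂ) * (∑ x, sg x ^ (j + 1)) * mom (m - j) N := by
  have h1 : mom (m + 1) (N + 1) = ∑ k : Fin (N + 1), ∑ f : Fin (N + 1) → Fin 2,
      sg (f k) * (∑ i, sg (f i)) ^ m := by
    rw [Finset.sum_comm]
    simp only [mom, ← Finset.sum_mul, pow_succ']
  have h2 : ∀ k : Fin (N + 1), ∑ f : Fin (N + 1) → Fin 2, sg (f k) * (∑ i, sg (f i)) ^ m
      = ∑ j ∈ Finset.range (m + 1),
      (m.choose j : ℂ) * (∑ x, sg x ^ (j + 1)) * mom (m - j) N := by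
    intro k
    rw [← (Fin.insertNthEquiv (fun _ => Fin 2) k).sum_comp, Fintype.sum_prod_type]
    simp only [Fin.insertNthEquiv_apply, Fin.insertNth_apply_same, Fin.sum_univ_succAbove _ k,
      Fin.insertNth_apply_succAbove, add_pow, mom, Finset.mul_sum, Finset.sum_mul]
    conv_lhs => enter [2, x]; rw [Finset.sum_comm]
    rw [Finset.sum_comm]
    refine Finset.sum_congr rfl fun j _ => ?_
    rw [Finset.sum_comm]
    refine Finset.sum_congr rfl fun g _ => Finset.sum_congr rfl fun x _ => ?_
    ring
  rw [h1, Finset.sum_congr rfl fun k _ => h2 k]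
  simp

lemma sum_sg_pow_even (i : ℕ) : ∑ x, sg x ^ (2 * i + 1) = 0 := by
  simp only [Fin.sum_univ_two, sg]
  have : Odd (2 * i + 1) := ⟨i, rfl⟩
  simp [neg_div, this.neg_pow]

lemma tendsto_inv_succ : Tendsto (fun N : ℕ => (1 : ℂ) / ((N : ℂ) + 1)) atTop (𝓝 0) :=
  tendsto_one_div_add_atTop_nhds_zero_nat

lemma tendsto_ratio : Tendsto (fun N : ℕ => (N : ℂ) / ((N : ℂ) + 1)) atTop (𝓝 1) := by
  have := tendsto_inv_succ.const_sub 1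
  rw [sub_zero] at this
  refine this.congr fun N => ?_
  have : (N : ℂ) + 1 ≠ 0 := Nat.cast_add_one_ne_zero N
  field_simp
  ring

lemma tendsto_mom (ℓ : ℕ) :
    Tendsto (fun N : ℕ => mom (2 * ℓ) N / (2 ^ N * (N : ℂ) ^ ℓ)) atTop
      (𝓝 ((Nat.factorial (2 * ℓ) : ℂ) / (2 ^ (3 * ℓ) * (Nat.factorial ℓ : ℂ)))) := by
  induction ℓ using Nat.strong_induction_on with
  | _ ℓ ih =>
  rcases ℓ with _ | ℓ
  · simp [mom]
  rw [← tendsto_add_atTop_iff_nat 1]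
  have hterm : ∀ j ∈ Finset.range (2 * ℓ + 1 + 1), Tendsto (fun N : ℕ =>
      ((2 * ℓ + 1).choose j : ℂ) * (∑ x, sg x ^ (j + 1)) / 2 *
        (mom (2 * ℓ + 1 - j) N / (2 ^ N * ((N : ℂ) + 1) ^ ℓ))) atTop
      (𝓝 (if j = 1 then (2 * ℓ + 1) / 4 *
        ((Nat.factorial (2 * ℓ) : ℂ) / (2 ^ (3 * ℓ) * (Nat.factorial ℓ : ℂ))) else 0)) := by
    intro j hj
    rw [Finset.mem_range] at hj
    obtain ⟨i, hi | hi⟩ := Nat.even_or_odd' j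
    · subst hi
      rw [sum_sg_pow_even, if_neg (by omega)]
      simp
    · subst hi
      have hle : i ≤ ℓ := by omega
      obtain ⟨d, rfl⟩ := Nat.exists_eq_add_of_le hle
      have e : 2 * (i + d) + 1 - (2 * i + 1) = 2 * d := by omega
      rw [e]
      have hlim := (ih d (by omega)).mul
        ((tendsto_ratio.pow d).mul (tendsto_inv_succ.pow i))
      have hlim' : Tendsto (fun N : ℕ => mom (2 * d) N / (2 ^ N * ((N : ℂ) + 1) ^ (i + d)))
          atTop (𝓝 ((Nat.factorial (2 * d) : ℂ) / (2 ^ (3 * d) * (Nat.factorial d : ℂ))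
            * (1 ^ d * 0 ^ i))) := by
        refine hlim.congr' ?_
        filter_upwards [eventually_ge_atTop 1] with N hN
        have h0 : (N : ℂ) ≠ 0 := by exact_mod_cast (by omega : N ≠ 0)
        have h1 : (N : ℂ) + 1 ≠ 0 := Nat.cast_add_one_ne_zero N
        rw [div_pow, div_pow, pow_add]
        field_simp
        try simp
      have := hlim'.const_mul
        (((2 * (i + d) + 1).choose (2 * i + 1) : ℂ) * (∑ x, sg x ^ (2 * i + 1 + 1)) / 2)
      convert this using 2
      rcases i with _ | i
      · simp [Fin.sum_univ_two, sg]
        left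
        ring
      · simp
  have hsum := tendsto_finset_sum _ hterm
  rw [Finset.sum_ite_eq' , if_pos (by simp)] at hsum
  convert hsum using 2
  · rename_i N
    rw [show 2 * (ℓ + 1) = (2 * ℓ + 1) + 1 by ring, mom_succ]
    have h1 : (N : ℂ) + 1 ≠ 0 := Nat.cast_add_one_ne_zero N
    rw [Finset.mul_sum, Finset.sum_div]
    refine Finset.sum_congr rfl fun j _ => ?_
    push_cast
    rw [pow_succ, pow_succ]
    field_simp
  · rw [show 2 * (ℓ + 1) = (2 * ℓ + 1) + 1 by ring, Nat.factorial_succ, Nat.factorial_succ,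
      Nat.factorial_succ, show 3 * (ℓ + 1) = 3 * ℓ + 3 by ring, pow_add]
    have h1 : (ℓ : ℂ) + 1 ≠ 0 := Nat.cast_add_one_ne_zero ℓ
    have h2 : (Nat.factorial ℓ : ℂ) ≠ 0 := Nat.cast_ne_zero.mpr (Nat.factorial_ne_zero ℓ)
    push_cast
    field_simp
    ring

/-- for every `α ∈ {x,y,z}` and every `ℓ ∈ ℕ`,
`lim_{N→∞} 2^{-N} N^{-ℓ} tr((Ŝ_α^{(N)})^{2ℓ}) = (2ℓ)! / (2^{3ℓ} ℓ!)`. -/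
theorem tendsto_trace_even_power_totalSpin (α : Fin 3) (ℓ : ℕ) :
    Tendsto (fun N : ℕ => (totalSpin N α ^ (2 * ℓ)).trace / (2 ^ N * (N : ℂ) ^ ℓ))
      atTop
      (𝓝 ((Nat.factorial (2 * ℓ) : ℂ) / (2 ^ (3 * ℓ) * (Nat.factorial ℓ : ℂ)))) := by
  simp only [trace_eq]
  exact tendsto_mom ℓ
end

section
/- For all distinct α, β ∈ {x, y, z} and all ℓ, m ∈ ℕ, the normalized mixed even moments converge and factorize: lim_{N→∞} 2^{-N} N^{-(ℓ+m)} tr((Ŝ_α^{(N)})^{2m} (Ŝ_β^{(N)})^{2ℓ}) = (2m)! (2ℓ)! / (2^{3m} 2^{3ℓ} m! ℓ!); in particular this limit equals the product of the limits lim_{N→∞} 2^{-N} N^{-m} tr((Ŝ_α^{(N)})^{2m}) and lim_{N→∞} 2^{-N} N^{-ℓ} tr((Ŝ_β^{(N)})^{2ℓ}). -/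
open Matrix Filter Topology MeasureTheory

lemma kronPow_trace (N : ℕ) (A : Fin N → Matrix (Fin 2) (Fin 2) ℂ) :
    (kronPow N A).trace = ∏ k, (A k).trace := by
  simp only [kronPow, Matrix.trace, Matrix.diag, Matrix.of_apply]
  rw [Finset.prod_univ_sum]
  simp [Fintype.piFinset_univ]

/-- fibre counts -/
def cnt {p N : ℕ} (f : Fin p → Fin N) (k : Fin N) : ℕ := ∑ i, if k = f i then 1 else 0

lemma totalSpin_pow (N : ℕ) (α : Fin 3) (p : ℕ) :
    totalSpin N α ^ p = ∑ f : Fin p → Fin N, kronPow N (fun k => spinMat α ^ cnt f k) := by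
  induction p with
  | zero => simp [cnt, kronPow_one]
  | succ p ih =>
    rw [pow_succ', ih, totalSpin, Finset.sum_mul_sum, ← Finset.sum_product',
      ← (Fin.consEquiv (fun _ : Fin (p + 1) => Fin N)).sum_comp, Finset.univ_product_univ]
    refine Finset.sum_congr rfl fun x _ => ?_
    rw [kronPow_mul]
    congr 1
    funext k
    simp only [cnt, Fin.consEquiv, Equiv.coe_fn_mk, Fin.sum_univ_succ, Fin.cons_zero,
      Fin.cons_succ, pow_add]
    split_ifs <;> simp

/-- eigenvalues -/
noncomputable def hval : Fin 2 → ℂ := ![1/2, -1/2]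

lemma spin_sq (α : Fin 3) : spinMat α ^ 2 = (1/4 : ℂ) • 1 := by
  fin_cases α <;> ext i j <;> fin_cases i <;> fin_cases j <;>
    simp [spinMat, pow_two, Matrix.mul_apply] <;> ring_nf <;> simp <;> norm_num

lemma spin_even (α : Fin 3) (i : ℕ) : spinMat α ^ (2 * i) = ((1/4 : ℂ) ^ i) • 1 := by
  rw [pow_mul, spin_sq, smul_pow, one_pow]

lemma spin_odd (α : Fin 3) (i : ℕ) : spinMat α ^ (2 * i + 1) = ((1/4 : ℂ) ^ i) • spinMat α := by
  rw [pow_succ, spin_even, smul_mul_assoc, one_mul]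

lemma spin_trace (α : Fin 3) : (spinMat α).trace = 0 := by
  fin_cases α <;> simp [spinMat, Matrix.trace, Fin.sum_univ_two] <;> ring

lemma spin_trace_mul (α β : Fin 3) (h : α ≠ β) : (spinMat α * spinMat β).trace = 0 := by
  fin_cases α <;> fin_cases β <;> first
    | exact absurd rfl h
    | (simp [spinMat, Matrix.trace, Fin.sum_univ_two] <;> try ring)

lemma hval_even (i : ℕ) : ∑ b, hval b ^ (2 * i) = 2 * (1/4 : ℂ) ^ i := by
  simp only [Fin.sum_univ_two, hval, pow_mul]
  norm_num
  ring

lemma hval_odd (i : ℕ) : ∑ b, hval b ^ (2 * i + 1) = 0 := by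
  simp only [Fin.sum_univ_two, hval, pow_mul, pow_succ]
  norm_num

lemma site (α β : Fin 3) (h : α ≠ β) (p q : ℕ) :
    2 * (spinMat α ^ p * spinMat β ^ q).trace = (∑ b, hval b ^ p) * (∑ b, hval b ^ q) := by
  obtain ⟨i, rfl | rfl⟩ := Nat.even_or_odd' p <;> obtain ⟨j, rfl | rfl⟩ := Nat.even_or_odd' q <;>
  simp only [spin_even, spin_odd, hval_even, hval_odd, smul_mul_assoc, mul_smul_comm, one_mul,
    mul_one, Matrix.trace_smul, spin_trace, spin_trace_mul α β h, Matrix.trace_one, smul_eq_mul,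
    mul_zero, zero_mul, Fintype.card_fin]
  push_cast
  ring

noncomputable def Gm (p N : ℕ) : ℂ := ∑ x : Fin N → Fin 2, (∑ k, hval (x k)) ^ p

lemma Gm_eq (p N : ℕ) : Gm p N = ∑ f : Fin p → Fin N, ∏ k, ∑ b, hval b ^ cnt f k := by
  have key : ∀ (f : Fin p → Fin N) (x : Fin N → Fin 2),
      ∏ i, hval (x (f i)) = ∏ k, hval (x k) ^ cnt f k := by
    intro f x
    simp only [cnt, ← Finset.prod_pow_eq_pow_sum]
    rw [Finset.prod_comm]
    refine Finset.prod_congr rfl fun i _ => ?_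
    rw [Finset.prod_eq_single (f i)]
    · simp
    · intro b _ hb; simp [hb]
    · simp
  simp only [Gm, Fintype.sum_pow, key]
  rw [Finset.sum_comm]
  refine Finset.sum_congr rfl fun f _ => ?_
  rw [Finset.prod_univ_sum]
  simp [Fintype.piFinset_univ]

lemma trace_eq_s3 (α β : Fin 3) (h : α ≠ β) (p q N : ℕ) :
    2 ^ N * (totalSpin N α ^ p * totalSpin N β ^ q).trace = Gm p N * Gm q N := by
  rw [totalSpin_pow, totalSpin_pow, Finset.sum_mul_sum, Matrix.trace_sum, Gm_eq, Gm_eq,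
    Finset.sum_mul_sum, Finset.mul_sum]
  refine Finset.sum_congr rfl fun f _ => ?_
  rw [Matrix.trace_sum, Finset.mul_sum]
  refine Finset.sum_congr rfl fun g _ => ?_
  rw [kronPow_mul, kronPow_trace, ← Finset.prod_mul_distrib]
  simp only [← site α β h, Finset.prod_mul_distrib]
  simp

noncomputable def ev : Fin 2 → ℝ := ![1, -1]

noncomputable def Rm (p N : ℕ) : ℝ := ∑ x : Fin N → Fin 2, (∑ k, ev (x k)) ^ p

lemma Gm_Rm (p N : ℕ) : Gm p N = (1/2) ^ p * (Rm p N : ℂ) := by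
  have hh : ∀ b, hval b = 1/2 * (ev b : ℂ) := by
    intro b; fin_cases b <;> simp [hval, ev]
    ring
  simp only [Gm, Rm, hh, ← Finset.mul_sum, mul_pow]
  push_cast
  rfl

lemma sum_even_odd (g : ℕ → ℝ) (m : ℕ) : ∑ j ∈ Finset.range (2 * m + 1), g j =
    ∑ i ∈ Finset.range (m + 1), g (2 * i) + ∑ i ∈ Finset.range m, g (2 * i + 1) := by
  induction m with
  | zero => simp
  | succ m ih =>
    rw [show 2 * (m + 1) + 1 = 2 * m + 1 + 1 + 1 by ring, Finset.sum_range_succ,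
      Finset.sum_range_succ, ih, Finset.sum_range_succ _ (m + 1),
      Finset.sum_range_succ (fun i => g (2 * i + 1)) m]
    rw [show 2 * (m + 1) = 2 * m + 1 + 1 by ring]
    ring

lemma binom_even (s : ℝ) (m : ℕ) : (1 + s) ^ (2 * m) + (-1 + s) ^ (2 * m) =
    2 * ∑ i ∈ Finset.range (m + 1), (Nat.choose (2 * m) (2 * i) : ℝ) * s ^ (2 * i) := by
  have h1 : (-1 + s) ^ (2 * m) = (-s + 1) ^ (2 * m) := by
    rw [pow_mul, pow_mul]; congr 1; ring
  rw [h1, add_comm 1 s, add_pow, add_pow, ← Finset.sum_add_distrib, sum_even_odd, Finset.mul_sum]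
  have h2 : ∀ i, (-s) ^ (2 * i + 1) = - s ^ (2 * i + 1) := fun i => Odd.neg_pow ⟨i, rfl⟩ s
  have h3 : ∀ i, (-s) ^ (2 * i) = s ^ (2 * i) := fun i => Even.neg_pow (even_two_mul i) s
  simp only [h2, h3, one_pow, mul_one, neg_mul, add_neg_cancel, Finset.sum_const_zero, add_zero]
  exact Finset.sum_congr rfl fun i _ => by ring

lemma Rm_succ (m N : ℕ) : Rm (2 * m) (N + 1) =
    2 * ∑ i ∈ Finset.range (m + 1), (Nat.choose (2 * m) (2 * i) : ℝ) * Rm (2 * i) N := by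
  have h : Rm (2 * m) (N + 1) = ∑ x : Fin N → Fin 2,
      ((1 + ∑ k, ev (x k)) ^ (2 * m) + (-1 + ∑ k, ev (x k)) ^ (2 * m)) := by
    rw [Rm, ← (Fin.consEquiv (fun _ : Fin (N + 1) => Fin 2)).sum_comp,
      ← Finset.univ_product_univ, Finset.sum_product, Fin.sum_univ_two, ← Finset.sum_add_distrib]
    refine Finset.sum_congr rfl fun x _ => ?_
    simp [Fin.consEquiv, Fin.sum_univ_succ, ev]
  rw [h]
  simp only [binom_even, Rm, Finset.mul_sum]
  rw [Finset.sum_comm]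

noncomputable def cm (m : ℕ) : ℝ := (Nat.factorial (2 * m) : ℝ) / (2 ^ m * Nat.factorial m)

lemma cm_succ (m : ℕ) : cm (m + 1) = (2 * m + 1) * cm m := by
  simp only [cm, show 2 * (m + 1) = 2 * m + 1 + 1 by ring, Nat.factorial_succ, pow_succ]
  push_cast
  field_simp
  ring

lemma cm_nonneg (m : ℕ) : 0 ≤ cm m := by unfold cm; positivity

lemma cm_ge (m : ℕ) : 1 ≤ cm m := by
  induction m with
  | zero => simp [cm]
  | succ m ih =>
    rw [cm_succ]
    have : (0 : ℝ) ≤ m := Nat.cast_nonneg m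
    nlinarith

lemma choose_cm (m i : ℕ) (h : i ≤ m) :
    (Nat.choose (2 * m) (2 * i) : ℝ) * cm i ≤ (Nat.choose m i : ℝ) * cm m := by
  have e : (Nat.choose m i : ℝ) * cm m =
      (Nat.choose (2 * m) (2 * i) : ℝ) * cm i * cm (m - i) := by
    obtain ⟨d, rfl⟩ := Nat.exists_eq_add_of_le h
    rw [Nat.cast_choose ℝ h, Nat.cast_choose ℝ (by omega : 2 * i ≤ 2 * (i + d)),
      show 2 * (i + d) - 2 * i = 2 * d by omega, show i + d - i = d by omega]
    simp only [cm, pow_add]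
    field_simp
  rw [e]
  exact le_mul_of_one_le_right (mul_nonneg (Nat.cast_nonneg _) (cm_nonneg i)) (cm_ge _)

lemma Rm_upper (N : ℕ) : ∀ m, Rm (2 * m) N ≤ 2 ^ N * (cm m * (N : ℝ) ^ m) := by
  induction N with
  | zero =>
    intro m
    rcases m with _ | m <;> simp [Rm, cm]
  | succ N ih =>
    intro m
    rw [Rm_succ, pow_succ', mul_assoc]
    refine mul_le_mul_of_nonneg_left ?_ zero_le_two
    push_cast
    rw [add_pow, Finset.mul_sum, Finset.mul_sum]
    refine Finset.sum_le_sum fun i hi => ?_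
    have hi' : i ≤ m := Nat.lt_succ_iff.mp (Finset.mem_range.mp hi)
    calc (Nat.choose (2 * m) (2 * i) : ℝ) * Rm (2 * i) N
        ≤ (Nat.choose (2 * m) (2 * i) : ℝ) * (2 ^ N * (cm i * (N : ℝ) ^ i)) :=
          mul_le_mul_of_nonneg_left (ih i) (Nat.cast_nonneg _)
      _ = ((Nat.choose (2 * m) (2 * i) : ℝ) * cm i) * (2 ^ N * (N : ℝ) ^ i) := by ring
      _ ≤ ((Nat.choose m i : ℝ) * cm m) * (2 ^ N * (N : ℝ) ^ i) :=
          mul_le_mul_of_nonneg_right (choose_cm m i hi') (by positivity)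
      _ = _ := by simp only [one_pow]; ring

lemma Rm_nonneg (m N : ℕ) : 0 ≤ Rm (2 * m) N :=
  Finset.sum_nonneg fun x _ => by rw [pow_mul]; positivity

lemma Rm_zero (N : ℕ) : Rm 0 N = 2 ^ N := by simp [Rm]

lemma Rm_lower (N : ℕ) : ∀ m, 2 ^ N * (cm m * (N.descFactorial m : ℝ)) ≤ Rm (2 * m) N := by
  induction N with
  | zero =>
    intro m
    rcases m with _ | m <;> simp [Rm, cm]
  | succ N ih =>
    intro m
    rcases m with _ | m
    · simp [Rm_zero, cm]
    rw [Rm_succ, pow_succ', mul_assoc]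
    refine mul_le_mul_of_nonneg_left ?_ zero_le_two
    rw [Finset.sum_range_succ, Finset.sum_range_succ]
    have h0 : 0 ≤ ∑ i ∈ Finset.range m, (Nat.choose (2 * (m + 1)) (2 * i) : ℝ) * Rm (2 * i) N :=
      Finset.sum_nonneg fun i _ => mul_nonneg (Nat.cast_nonneg _) (Rm_nonneg i N)
    have hd : ((N + 1).descFactorial (m + 1) : ℝ) =
        N.descFactorial (m + 1) + (m + 1) * N.descFactorial m := by
      rw [Nat.succ_descFactorial_succ, Nat.descFactorial_succ]
      rcases le_or_gt m N with hm | hm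
      · push_cast [Nat.cast_sub hm]; ring
      · simp [Nat.descFactorial_eq_zero_iff_lt.mpr hm]
    have hc : (Nat.choose (2 * (m + 1)) (2 * m) : ℝ) = (m + 1) * (2 * m + 1) := by
      rw [← Nat.choose_symm_of_eq_add (show 2 * (m + 1) = 2 + 2 * m by ring), Nat.cast_choose_two]
      push_cast
      ring
    have h1 := ih (m + 1)
    have h2 := mul_le_mul_of_nonneg_left (ih m)
      (by positivity : (0 : ℝ) ≤ (m + 1) * (2 * m + 1))
    rw [hd, hc, Nat.choose_self, cm_succ] 
    rw [cm_succ] at h1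
    push_cast
    nlinarith

lemma desc_tendsto (m : ℕ) :
    Tendsto (fun N : ℕ => (N.descFactorial m : ℝ) / (N : ℝ) ^ m) atTop (𝓝 1) := by
  induction m with
  | zero => simp
  | succ m ih =>
    have h1 : Tendsto (fun N : ℕ => 1 - (m : ℝ) / (N : ℝ)) atTop (𝓝 (1 - 0)) :=
      tendsto_const_nhds.sub (tendsto_const_div_atTop_nhds_zero_nat (m : ℝ))
    have h2 := h1.mul ih
    rw [sub_zero, one_mul] at h2
    refine h2.congr' ?_
    filter_upwards [eventually_ge_atTop (m + 1)] with N hN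
    have : (N : ℝ) ≠ 0 := by
      have : N ≠ 0 := by omega
      exact_mod_cast this
    rw [Nat.descFactorial_succ]
    push_cast [Nat.cast_sub (show m ≤ N by omega)]
    field_simp
    ring

lemma Rm_tendsto (m : ℕ) :
    Tendsto (fun N : ℕ => Rm (2 * m) N / (2 ^ N * (N : ℝ) ^ m)) atTop (𝓝 (cm m)) := by
  have hl := (desc_tendsto m).const_mul (cm m)
  rw [mul_one] at hl
  refine tendsto_of_tendsto_of_tendsto_of_le_of_le' hl tendsto_const_nhds ?_ ?_
  · filter_upwards [eventually_gt_atTop 0] with N hN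
    have : (0 : ℝ) < N := by exact_mod_cast hN
    rw [← mul_div_assoc, div_le_div_iff₀ (by positivity) (by positivity)]
    have := mul_le_mul_of_nonneg_right (Rm_lower N m) (by positivity : (0 : ℝ) ≤ (N : ℝ) ^ m)
    linarith
  · filter_upwards [eventually_gt_atTop 0] with N hN
    have : (0 : ℝ) < N := by exact_mod_cast hN
    rw [div_le_iff₀ (by positivity)]
    have := Rm_upper N m
    linarith

lemma Gm_tendsto (m : ℕ) :
    Tendsto (fun N : ℕ => Gm (2 * m) N / (2 ^ N * (N : ℂ) ^ m)) atTop
      (𝓝 ((Nat.factorial (2 * m) : ℂ) / (2 ^ (3 * m) * (Nat.factorial m : ℂ)))) := by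
  have h := ((Complex.continuous_ofReal.tendsto _).comp (Rm_tendsto m)).const_mul
    ((1 / 2 : ℂ) ^ (2 * m))
  have e : (1 / 2 : ℂ) ^ (2 * m) * (cm m : ℂ) =
      (Nat.factorial (2 * m) : ℂ) / (2 ^ (3 * m) * (Nat.factorial m : ℂ)) := by
    simp only [cm]
    push_cast
    rw [show 3 * m = 2 * m + m by ring, pow_add, one_div, inv_pow]
    field_simp
  rw [e] at h
  refine h.congr fun N => ?_
  simp only [Function.comp, Gm_Rm]
  push_cast
  ring

lemma mixed (α β : Fin 3) (hαβ : α ≠ β) (ℓ m : ℕ) :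
    Tendsto (fun N : ℕ =>
        (totalSpin N α ^ (2 * m) * totalSpin N β ^ (2 * ℓ)).trace / (2 ^ N * (N : ℂ) ^ (ℓ + m)))
      atTop
      (𝓝 ((Nat.factorial (2 * m) : ℂ) * (Nat.factorial (2 * ℓ) : ℂ) /
        (2 ^ (3 * m) * 2 ^ (3 * ℓ) * (Nat.factorial m : ℂ) * (Nat.factorial ℓ : ℂ)))) := by
  have h := (Gm_tendsto m).mul (Gm_tendsto ℓ)
  have e : (Nat.factorial (2 * m) : ℂ) / (2 ^ (3 * m) * (Nat.factorial m : ℂ)) *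
      ((Nat.factorial (2 * ℓ) : ℂ) / (2 ^ (3 * ℓ) * (Nat.factorial ℓ : ℂ))) =
      (Nat.factorial (2 * m) : ℂ) * (Nat.factorial (2 * ℓ) : ℂ) /
        (2 ^ (3 * m) * 2 ^ (3 * ℓ) * (Nat.factorial m : ℂ) * (Nat.factorial ℓ : ℂ)) := by
    rw [div_mul_div_comm]; congr 1; ring
  rw [e] at h
  refine h.congr fun N => ?_
  have h2 : (2 : ℂ) ^ N ≠ 0 := pow_ne_zero _ two_ne_zero
  rw [div_mul_div_comm, ← trace_eq_s3 α β hαβ, pow_add,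
    show (2 : ℂ) ^ N * (N : ℂ) ^ m * (2 ^ N * (N : ℂ) ^ ℓ) =
      2 ^ N * (2 ^ N * ((N : ℂ) ^ ℓ * (N : ℂ) ^ m)) by ring, mul_div_mul_left _ _ h2]

/-- for all distinct `α, β ∈ {x,y,z}` and all `ℓ, m ∈ ℕ`, the normalized
mixed even moments converge,
`lim_{N→∞} 2^{-N} N^{-(ℓ+m)} tr((Ŝ_α^{(N)})^{2m} (Ŝ_β^{(N)})^{2ℓ}) =
  (2m)! (2ℓ)! / (2^{3m} 2^{3ℓ} m! ℓ!)`,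
and this limit factorizes as the product of the two individual moment limits. -/
theorem tendsto_trace_mixed_even_power_totalSpin (α β : Fin 3) (hαβ : α ≠ β) (ℓ m : ℕ) :
    Tendsto (fun N : ℕ =>
        (totalSpin N α ^ (2 * m) * totalSpin N β ^ (2 * ℓ)).trace / (2 ^ N * (N : ℂ) ^ (ℓ + m)))
      atTop
      (𝓝 ((Nat.factorial (2 * m) : ℂ) * (Nat.factorial (2 * ℓ) : ℂ) /
        (2 ^ (3 * m) * 2 ^ (3 * ℓ) * (Nat.factorial m : ℂ) * (Nat.factorial ℓ : ℂ)))) ∧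
    Tendsto (fun N : ℕ =>
        ((totalSpin N α ^ (2 * m)).trace / (2 ^ N * (N : ℂ) ^ m)) *
          ((totalSpin N β ^ (2 * ℓ)).trace / (2 ^ N * (N : ℂ) ^ ℓ)))
      atTop
      (𝓝 ((Nat.factorial (2 * m) : ℂ) * (Nat.factorial (2 * ℓ) : ℂ) /
        (2 ^ (3 * m) * 2 ^ (3 * ℓ) * (Nat.factorial m : ℂ) * (Nat.factorial ℓ : ℂ)))) := by
  refine ⟨mixed α β hαβ ℓ m, ?_⟩
  have h := (mixed α β hαβ 0 m).mul (mixed β α hαβ.symm 0 ℓ)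
  simp only [mul_zero, pow_zero, mul_one, zero_add, Nat.factorial_zero, Nat.cast_one] at h
  rw [div_mul_div_comm] at h
  convert h using 2
  congr 1
  ring
end

section
/- For all m, ℓ ∈ ℕ, the normalized traces of ordered monomials in the raising and lowering operators converge: lim_{N→∞} 2^{-N} N^{-(m+ℓ)/2} tr((Ŝ_+^{(N)})^m (Ŝ_-^{(N)})^ℓ) = δ_{mℓ} · m!/2^m, where δ_{mℓ} is the Kronecker delta. -/
open Matrix Filter Topology MeasureTheory

/-- The total raising operator `Ŝ_+^{(N)} = Ŝ_x^{(N)} + i Ŝ_y^{(N)}`. -/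
noncomputable def totalSpinPlus (N : ℕ) : Matrix (Fin N → Fin 2) (Fin N → Fin 2) ℂ :=
  totalSpin N 0 + Complex.I • totalSpin N 1

/-- The total lowering operator `Ŝ_-^{(N)} = Ŝ_x^{(N)} - i Ŝ_y^{(N)}`. -/
noncomputable def totalSpinMinus (N : ℕ) : Matrix (Fin N → Fin 2) (Fin N → Fin 2) ℂ :=
  totalSpin N 0 - Complex.I • totalSpin N 1

/-- `f ≤ g` pointwise with exactly `m` differences. -/
def DiffBy {N : ℕ} (m : ℕ) (f g : Fin N → Fin 2) : Prop :=
  (∀ k, f k ≤ g k) ∧ (Finset.univ.filter fun k => f k ≠ g k).card = m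

lemma one_site_plus {N : ℕ} (f g : Fin N → Fin 2) :
    totalSpinPlus N f g =
      ∑ j : Fin N, if g j = 1 ∧ f = Function.update g j 0 then (1 : ℂ) else 0 := by
  unfold totalSpinPlus totalSpin
  simp only [Matrix.add_apply, Matrix.smul_apply, Matrix.sum_apply, smul_eq_mul, Finset.mul_sum]
  rw [← Finset.sum_add_distrib]
  refine Finset.sum_congr rfl fun j _ => ?_
  simp only [kronPow, Matrix.of_apply]
  rw [← Finset.mul_prod_erase _ _ (Finset.mem_univ j), ← Finset.mul_prod_erase _ _ (Finset.mem_univ j)]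
  have h : ∀ α, ∏ x ∈ Finset.univ.erase j, (if x = j then spinMat α else 1) (f x) (g x)
      = if (∀ x, x ≠ j → f x = g x) then (1 : ℂ) else 0 := by
    intro α
    rw [Finset.prod_congr rfl (g := fun x => if f x = g x then (1 : ℂ) else 0)]
    · rw [Finset.prod_ite_zero]
      simp
    · intro x hx
      rw [if_neg (Finset.ne_of_mem_erase hx), Matrix.one_apply]
  rw [h, h, if_pos rfl, if_pos rfl]
  have h2 : (f = Function.update g j 0) ↔ (f j = 0 ∧ ∀ x, x ≠ j → f x = g x) := by
    rw [Function.eq_update_iff]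
  by_cases hh : ∀ x, x ≠ j → f x = g x
  · rw [if_pos hh]
    simp only [h2, and_iff_left hh]
    generalize f j = a
    generalize g j = b
    fin_cases a <;> fin_cases b <;> simp [spinMat] <;> ring_nf <;> simp [Complex.I_sq] <;> norm_num
  · simp [h2, hh]

lemma one_site_minus {N : ℕ} (f g : Fin N → Fin 2) :
    totalSpinMinus N f g = totalSpinPlus N g f := by
  unfold totalSpinMinus totalSpinPlus totalSpin
  simp only [Matrix.add_apply, Matrix.sub_apply, Matrix.smul_apply, Matrix.sum_apply, smul_eq_mul,
    Finset.mul_sum]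
  rw [← Finset.sum_add_distrib, ← Finset.sum_sub_distrib]
  refine Finset.sum_congr rfl fun j _ => ?_
  simp only [kronPow, Matrix.of_apply]
  rw [← Finset.mul_prod_erase _ _ (Finset.mem_univ j), ← Finset.mul_prod_erase _ _ (Finset.mem_univ j),
    ← Finset.mul_prod_erase _ _ (Finset.mem_univ j), ← Finset.mul_prod_erase _ _ (Finset.mem_univ j)]
  have h : ∀ α (f g : Fin N → Fin 2), ∏ x ∈ Finset.univ.erase j, (if x = j then spinMat α else 1) (f x) (g x)
      = ∏ x ∈ Finset.univ.erase j, (1 : Matrix (Fin 2) (Fin 2) ℂ) (f x) (g x) := by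
    intro α f g
    refine Finset.prod_congr rfl fun x hx => ?_
    rw [if_neg (Finset.ne_of_mem_erase hx)]
  have h' : ∏ x ∈ Finset.univ.erase j, (1 : Matrix (Fin 2) (Fin 2) ℂ) (f x) (g x)
      = ∏ x ∈ Finset.univ.erase j, (1 : Matrix (Fin 2) (Fin 2) ℂ) (g x) (f x) := by
    refine Finset.prod_congr rfl fun x hx => ?_
    simp [Matrix.one_apply, eq_comm]
  simp only [h, h', if_true]
  generalize f j = a
  generalize g j = b
  fin_cases a <;> fin_cases b <;> simp [spinMat] <;> ring

lemma minus_eq {N : ℕ} : totalSpinMinus N = (totalSpinPlus N)ᵀ := by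
  ext f g
  exact one_site_minus f g

lemma diff_update {N : ℕ} (m : ℕ) (f h : Fin N → Fin 2) (j : Fin N) :
    (h j = 1 ∧ DiffBy m f (Function.update h j 0)) ↔ (f j ≠ h j ∧ DiffBy (m + 1) f h) := by
  constructor
  · rintro ⟨h1, hle, hc⟩
    have h0 : f j = 0 := by have := hle j; simpa using this
    refine ⟨by rw [h0, h1]; decide, ?_, ?_⟩
    · intro k
      by_cases hk : k = j
      · subst hk; rw [h0]; simp
      · simpa [hk] using hle k
    · rw [← hc, ← Finset.card_insert_of_notMem (a := j) (by simp [h0])]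
      congr 1
      ext k
      by_cases hk : k = j
      · subst hk; simp [h0, h1]
      · simp [hk]
  · rintro ⟨hne, hle, hc⟩
    have h01 : f j = 0 ∧ h j = 1 := by
      have := hle j
      revert hne this
      generalize f j = a
      generalize h j = b
      revert a b; decide
    obtain ⟨h0, h1⟩ := h01
    refine ⟨h1, ?_, ?_⟩
    · intro k
      by_cases hk : k = j
      · subst hk; simp [h0]
      · simpa [hk] using hle k
    · have : (Finset.univ.filter fun k => f k ≠ h k) =
          insert j (Finset.univ.filter fun k => f k ≠ Function.update h j 0 k) := by
        ext k
        by_cases hk : k = j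
        · subst hk; simp [h0, h1]
        · simp [hk]
      rw [this, Finset.card_insert_of_notMem (by simp [h0])] at hc
      omega

open Classical in
lemma plus_pow {N : ℕ} (m : ℕ) (f h : Fin N → Fin 2) :
    (totalSpinPlus N ^ m) f h = if DiffBy m f h then (m.factorial : ℂ) else 0 := by
  induction m generalizing h with
  | zero =>
    have : DiffBy 0 f h ↔ f = h := by
      constructor
      · rintro ⟨-, hc⟩
        rw [Finset.card_eq_zero, Finset.filter_eq_empty_iff] at hc
        funext k
        simpa using hc (Finset.mem_univ k)
      · rintro rfl
        simp [DiffBy]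
    simp [Matrix.one_apply, this]
  | succ m ih =>
    rw [pow_succ, Matrix.mul_apply]
    simp only [one_site_plus, Finset.mul_sum]
    rw [Finset.sum_comm]
    have : ∀ j : Fin N, ∑ g, (totalSpinPlus N ^ m) f g *
        (if h j = 1 ∧ g = Function.update h j 0 then (1 : ℂ) else 0)
        = if f j ≠ h j ∧ DiffBy (m + 1) f h then (m.factorial : ℂ) else 0 := by
      intro j
      rw [← if_congr (diff_update m f h j) rfl rfl]
      by_cases h1 : h j = 1
      · simp [h1, ih]
      · simp [h1]
    rw [Finset.sum_congr rfl fun j _ => this j]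
    by_cases hd : DiffBy (m + 1) f h
    · simp only [hd, and_true, if_true]
      rw [← Finset.sum_filter, Finset.sum_const, hd.2, Nat.factorial_succ]
      simp
    · simp [hd]

open Classical in
lemma trace_eq_s6 (N m ℓ : ℕ) : (totalSpinPlus N ^ m * totalSpinMinus N ^ ℓ).trace =
    ∑ f : Fin N → Fin 2, ∑ g : Fin N → Fin 2,
      (if DiffBy m f g then (m.factorial : ℂ) else 0) *
        (if DiffBy ℓ f g then (ℓ.factorial : ℂ) else 0) := by
  simp only [Matrix.trace, Matrix.diag, Matrix.mul_apply, minus_eq, ← Matrix.transpose_pow,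
    Matrix.transpose_apply, plus_pow]

open Polynomial in
open Classical in
lemma gen_fun (N m : ℕ) : ∑ f : Fin N → Fin 2, ∑ g : Fin N → Fin 2,
      (if DiffBy m f g then (1 : ℂ) else 0) = 2 ^ (N - m) * (N.choose m : ℂ) := by
  let c : Fin 2 × Fin 2 → ℂ[X] := fun p => if p.1 ≤ p.2 then (if p.1 ≠ p.2 then X else 1) else 0
  have hc : ∑ p, c p = X + C 2 := by
    rw [Fintype.sum_prod_type]
    simp [c, Fin.sum_univ_two]
    have : (C 2 : ℂ[X]) = 1 + 1 := by rw [one_add_one_eq_two]; rfl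
    rw [this]; ring
  have h := coeff_X_add_C_pow (2 : ℂ) N m
  rw [← h, ← hc, Fintype.sum_pow, finsetSum_coeff,
    ← (Equiv.arrowProdEquivProdArrow (Fin N) (fun _ => Fin 2) (fun _ => Fin 2)).symm.sum_comp,
    Fintype.sum_prod_type]
  refine Finset.sum_congr rfl fun f _ => Finset.sum_congr rfl fun g _ => ?_
  have : ∏ i, c ((Equiv.arrowProdEquivProdArrow (Fin N) (fun _ => Fin 2) (fun _ => Fin 2)).symm
      (f, g) i) = if ∀ k, f k ≤ g k then X ^ (Finset.univ.filter fun k => f k ≠ g k).card else 0 := by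
    simp only [c, Equiv.arrowProdEquivProdArrow]
    simp only [Equiv.coe_fn_symm_mk]
    rw [Finset.prod_ite_zero]
    simp only [Finset.mem_univ, true_imp_iff]
    rw [Finset.prod_ite]
    simp
  rw [this]
  by_cases hle : ∀ k, f k ≤ g k
  · rw [if_pos hle, coeff_X_pow]
    simp [DiffBy, hle, eq_comm]
  · simp [DiffBy, hle]

lemma trace_ne (N m ℓ : ℕ) (hne : m ≠ ℓ) :
    (totalSpinPlus N ^ m * totalSpinMinus N ^ ℓ).trace = 0 := by
  classical
  rw [trace_eq_s6]
  refine Finset.sum_eq_zero fun f _ => Finset.sum_eq_zero fun g _ => ?_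
  by_cases h1 : DiffBy m f g
  · have : ¬ DiffBy ℓ f g := fun h2 => hne (h1.2.symm.trans h2.2)
    simp [this]
  · simp [h1]

lemma trace_same (N m : ℕ) :
    (totalSpinPlus N ^ m * totalSpinMinus N ^ m).trace =
      (m.factorial : ℂ) * N.descFactorial m * 2 ^ (N - m) := by
  classical
  rw [trace_eq_s6, Nat.descFactorial_eq_factorial_mul_choose]
  have := gen_fun N m
  have h2 : ∀ f g : Fin N → Fin 2, (if DiffBy m f g then (m.factorial : ℂ) else 0) *
        (if DiffBy m f g then (m.factorial : ℂ) else 0) =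
        (m.factorial : ℂ) ^ 2 * (if DiffBy m f g then (1 : ℂ) else 0) := by
    intro f g
    split_ifs <;> ring
  simp only [h2, ← Finset.mul_sum]
  rw [this]
  push_cast
  ring

/-- for all `m, ℓ ∈ ℕ`,
`lim_{N→∞} 2^{-N} N^{-(m+ℓ)/2} tr((Ŝ_+^{(N)})^m (Ŝ_-^{(N)})^ℓ) = δ_{mℓ} m!/2^m`. -/
theorem tendsto_trace_raising_lowering_monomial (m ℓ : ℕ) :
    Tendsto (fun N : ℕ =>
        (totalSpinPlus N ^ m * totalSpinMinus N ^ ℓ).trace /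
          (2 ^ N * ((Real.sqrt N : ℂ)) ^ (m + ℓ)))
      atTop
      (𝓝 (if m = ℓ then (Nat.factorial m : ℂ) / 2 ^ m else 0)) := by
  by_cases hml : m = ℓ
  · subst hml
    rw [if_pos rfl]
    have key : Tendsto (fun N : ℕ => (N.descFactorial m : ℝ) / (N : ℝ) ^ m) atTop (𝓝 1) := by
      have h := isEquivalent_descFactorial m
      rw [Asymptotics.isEquivalent_iff_tendsto_one] at h
      · exact h
      · filter_upwards [eventually_gt_atTop 0] with N hN
        positivity
    have key2 : Tendsto (fun N : ℕ => (((N.descFactorial m : ℝ) / (N : ℝ) ^ m : ℝ) : ℂ)) atTop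
        (𝓝 ((1 : ℝ) : ℂ)) := (Complex.continuous_ofReal.tendsto 1).comp key
    have key3 := key2.const_mul ((m.factorial : ℂ) / 2 ^ m)
    rw [Complex.ofReal_one, mul_one] at key3
    refine key3.congr' ?_
    filter_upwards [eventually_ge_atTop (m + 1)] with N hN
    rw [trace_same, ← two_mul, pow_mul, ← Complex.ofReal_pow, Real.sq_sqrt (Nat.cast_nonneg N)]
    have hN0 : (N : ℂ) ≠ 0 := by
      have : N ≠ 0 := by omega
      exact_mod_cast this
    have h2 : (2 : ℂ) ^ N = 2 ^ (N - m) * 2 ^ m := by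
      rw [← pow_add]; congr 1; omega
    rw [h2]
    push_cast
    field_simp
  · rw [if_neg hml]
    simp [trace_ne _ _ _ hml]
end

section
/- For every ℓ ∈ ℕ, lim_{N→∞} 2^{-N} N^{-ℓ} Σ_{k=0}^{N} C(N,k) (N/2 − k)^{2ℓ} = (2ℓ)!/(2^{3ℓ} ℓ!); i.e., the normalized even moments of the symmetric binomial distribution scaled by 1/√N converge to the moments of a centered Gaussian of variance 1/4. -/
open Filter Topology

lemma aux_stein (N : ℕ) (f : ℝ → ℝ) :
    ∑ k ∈ Finset.range (N + 1 + 1), ((N + 1).choose k : ℝ) *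
        ((((N + 1 : ℕ) : ℝ) / 2 - k) * f (((N + 1 : ℕ) : ℝ) / 2 - k)) =
      ((N : ℝ) + 1) / 2 * ∑ k ∈ Finset.range (N + 1), (N.choose k : ℝ) *
        (f ((N : ℝ) / 2 - k + 1 / 2) - f ((N : ℝ) / 2 - k - 1 / 2)) := by
  have h1 : ∑ k ∈ Finset.range (N + 1 + 1), ((N + 1).choose k : ℝ) *
        (((N : ℝ) + 1 - k) * f (((N + 1 : ℕ) : ℝ) / 2 - k)) =
      ((N : ℝ) + 1) * ∑ k ∈ Finset.range (N + 1), (N.choose k : ℝ) *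
        f ((N : ℝ) / 2 - k + 1 / 2) := by
    rw [Finset.sum_range_succ, Finset.mul_sum]
    have : ((N : ℝ) + 1 - ((N + 1 : ℕ) : ℝ)) = 0 := by push_cast; ring
    rw [this, zero_mul, mul_zero, add_zero]
    refine Finset.sum_congr rfl fun k hk => ?_
    have hk' : k ≤ N := by simpa [Nat.lt_succ_iff] using hk
    have h := Nat.choose_mul_succ_eq N k
    have h2 : (N.choose k : ℝ) * ((N : ℝ) + 1) = ((N + 1).choose k : ℝ) * ((N : ℝ) + 1 - k) := by
      have := congrArg (Nat.cast : ℕ → ℝ) h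
      rw [Nat.cast_mul, Nat.cast_mul, Nat.cast_sub (by omega)] at this
      push_cast at this
      exact this
    have h3 : ((N + 1 : ℕ) : ℝ) / 2 - k = (N : ℝ) / 2 - k + 1 / 2 := by push_cast; ring
    rw [h3]
    linear_combination (-f ((N : ℝ) / 2 - k + 1 / 2)) * h2
  have h2 : ∑ k ∈ Finset.range (N + 1 + 1), ((N + 1).choose k : ℝ) *
        ((k : ℝ) * f (((N + 1 : ℕ) : ℝ) / 2 - k)) =
      ((N : ℝ) + 1) * ∑ k ∈ Finset.range (N + 1), (N.choose k : ℝ) *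
        f ((N : ℝ) / 2 - k - 1 / 2) := by
    rw [Finset.sum_range_succ', Finset.mul_sum]
    rw [Nat.cast_zero, zero_mul, mul_zero, add_zero]
    refine Finset.sum_congr rfl fun k hk => ?_
    have h := Nat.add_one_mul_choose_eq N k
    have h2 : ((N : ℝ) + 1) * (N.choose k : ℝ) = ((N + 1).choose (k + 1) : ℝ) * ((k : ℝ) + 1) := by
      exact_mod_cast h
    have h3 : ((N + 1 : ℕ) : ℝ) / 2 - ((k + 1 : ℕ) : ℝ) = (N : ℝ) / 2 - k - 1 / 2 := by
      push_cast; ring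
    rw [h3]
    push_cast
    linear_combination (-f ((N : ℝ) / 2 - k - 1 / 2)) * h2
  simp only [mul_sub, Finset.sum_sub_distrib]
  rw [mul_comm_div, mul_comm_div, mul_div_assoc', mul_div_assoc', ← h1, ← h2,
    ← sub_div, ← Finset.sum_sub_distrib, Finset.sum_div]
  refine Finset.sum_congr rfl fun k _ => ?_
  push_cast
  ring

lemma aux_pair (n : ℕ) (g : ℕ → ℝ) :
    ∑ j ∈ Finset.range (2 * n), g j = ∑ i ∈ Finset.range n, (g (2 * i) + g (2 * i + 1)) := by
  induction n with
  | zero => simp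
  | succ n ih =>
    rw [show 2 * (n + 1) = 2 * n + 1 + 1 by ring, Finset.sum_range_succ, Finset.sum_range_succ, ih,
      Finset.sum_range_succ]
    ring

lemma aux_diff (m : ℕ) (y : ℝ) :
    (y + 1 / 2) ^ (2 * m + 1) - (y - 1 / 2) ^ (2 * m + 1) =
      ∑ i ∈ Finset.range (m + 1), ((2 * m + 1).choose (2 * i) : ℝ) * (1 / 4) ^ (m - i) *
        y ^ (2 * i) := by
  rw [sub_eq_add_neg y, add_pow, add_pow, ← Finset.sum_sub_distrib,
    show 2 * m + 1 + 1 = 2 * (m + 1) by ring, aux_pair]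
  refine Finset.sum_congr rfl fun i hi => ?_
  have hi' : i ≤ m := by simpa [Nat.lt_succ_iff] using hi
  obtain ⟨d, rfl⟩ := Nat.exists_eq_add_of_le hi'
  have e1 : 2 * (i + d) + 1 - 2 * i = 2 * d + 1 := by omega
  have e2 : 2 * (i + d) + 1 - (2 * i + 1) = 2 * d := by omega
  have e3 : i + d - i = d := by omega
  rw [e1, e2, e3, pow_succ _ (2 * d), pow_succ _ (2 * d), pow_mul _ 2 d, pow_mul _ 2 d]
  norm_num
  ring

lemma aux_rec (N m : ℕ) :
    ∑ k ∈ Finset.range (N + 1 + 1), ((N + 1).choose k : ℝ) *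
        (((N + 1 : ℕ) : ℝ) / 2 - k) ^ (2 * (m + 1)) =
      ((N : ℝ) + 1) / 2 * ∑ i ∈ Finset.range (m + 1),
        ((2 * m + 1).choose (2 * i) : ℝ) * (1 / 4) ^ (m - i) *
        ∑ k ∈ Finset.range (N + 1), (N.choose k : ℝ) * ((N : ℝ) / 2 - k) ^ (2 * i) := by
  have h := aux_stein N (fun x => x ^ (2 * m + 1))
  simp only [aux_diff, ← pow_succ'] at h
  rw [show 2 * (m + 1) = 2 * m + 1 + 1 by ring, h]
  congr 1
  simp only [Finset.mul_sum]
  rw [Finset.sum_comm]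
  refine Finset.sum_congr rfl fun i _ => Finset.sum_congr rfl fun k _ => ?_
  ring

lemma aux_ratio (i d : ℕ) :
    Tendsto (fun N : ℕ => (N : ℝ) ^ i / ((N : ℝ) + 1) ^ (i + d)) atTop
      (𝓝 (if d = 0 then 1 else 0)) := by
  have h1 : Tendsto (fun N : ℕ => (N : ℝ) / ((N : ℝ) + 1)) atTop (𝓝 1) :=
    tendsto_natCast_div_add_atTop (1 : ℝ)
  have h2 : Tendsto (fun N : ℕ => 1 / ((N : ℝ) + 1)) atTop (𝓝 0) :=
    tendsto_one_div_add_atTop_nhds_zero_nat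
  have h := (h1.pow i).mul (h2.pow d)
  rw [one_pow, one_mul, zero_pow_eq] at h
  refine h.congr fun N => ?_
  rw [div_pow, div_pow, one_pow, pow_add, div_mul_div_comm, mul_one]

/-- for every `ℓ ∈ ℕ`,
`lim_{N→∞} 2^{-N} N^{-ℓ} Σ_{k=0}^{N} C(N,k) (N/2 − k)^{2ℓ} = (2ℓ)!/(2^{3ℓ} ℓ!)`:
the normalized even moments of the symmetric binomial distribution scaled by `1/√N`
converge to the moments of a centered Gaussian of variance 1/4. -/
theorem tendsto_binomial_even_moments (ℓ : ℕ) :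
    Tendsto (fun N : ℕ =>
        (∑ k ∈ Finset.range (N + 1), (N.choose k : ℝ) * ((N : ℝ) / 2 - k) ^ (2 * ℓ)) /
          (2 ^ N * (N : ℝ) ^ ℓ))
      atTop
      (𝓝 ((Nat.factorial (2 * ℓ) : ℝ) / (2 ^ (3 * ℓ) * (Nat.factorial ℓ : ℝ)))) := by
  induction ℓ using Nat.strong_induction_on with
  | _ ℓ ih =>
  rcases ℓ with _ | m
  · have : ∀ N : ℕ, (∑ k ∈ Finset.range (N + 1), (N.choose k : ℝ)) = 2 ^ N := fun N => by
      exact_mod_cast Nat.sum_range_choose N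
    simp [this]
  · rw [← tendsto_add_atTop_iff_nat 1]
    have key := (tendsto_finset_sum (Finset.range (m + 1)) (fun i hi =>
      (((ih i (Finset.mem_range.1 hi)).mul (aux_ratio i (m - i))).const_mul
        (((2 * m + 1).choose (2 * i) : ℝ) * (1 / 4) ^ (m - i))))).const_mul (1 / 4 : ℝ)
    have hlim : (1 / 4 : ℝ) * ∑ i ∈ Finset.range (m + 1),
        ((2 * m + 1).choose (2 * i) : ℝ) * (1 / 4) ^ (m - i) *
        ((Nat.factorial (2 * i) : ℝ) / (2 ^ (3 * i) * (Nat.factorial i : ℝ)) *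
          (if m - i = 0 then 1 else 0)) =
        (Nat.factorial (2 * (m + 1)) : ℝ) / (2 ^ (3 * (m + 1)) * (Nat.factorial (m + 1) : ℝ)) := by
      rw [Finset.sum_range_succ, Finset.sum_eq_zero]
      · have : (2 * m + 1).choose (2 * m) = 2 * m + 1 := Nat.choose_succ_self_right (2 * m)
        rw [this, show 2 * (m + 1) = 2 * m + 1 + 1 by ring, Nat.factorial_succ, Nat.factorial_succ,
          Nat.factorial_succ]
        have : (Nat.factorial m : ℝ) ≠ 0 := by positivity
        have : (m : ℝ) + 1 ≠ 0 := by positivity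
        push_cast
        simp only [Nat.sub_self, pow_zero, if_true, mul_add, pow_add]
        field_simp
        ring
      · intro i hi
        have : m - i ≠ 0 := by have := Finset.mem_range.1 hi; omega
        simp [this]
    rw [hlim] at key
    refine key.congr' ?_
    filter_upwards [eventually_gt_atTop 0] with N hN
    rw [aux_rec, Finset.mul_sum, Finset.mul_sum, Finset.sum_div]
    refine Finset.sum_congr rfl fun i hi => ?_
    have hi' : i + (m - i) = m := by have := Finset.mem_range.1 hi; omega
    have hN' : (N : ℝ) ≠ 0 := by positivity
    have hN1 : (N : ℝ) + 1 ≠ 0 := by positivity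
    rw [hi']
    generalize (∑ k ∈ Finset.range (N + 1), (N.choose k : ℝ) * ((N : ℝ) / 2 - k) ^ (2 * i)) = S
    generalize ((2 * m + 1).choose (2 * i) : ℝ) * (1 / 4) ^ (m - i) = c
    push_cast
    rw [pow_succ, pow_succ]
    field_simp
    try ring
end
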